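/- arXiv:0802.3761 — 2 statements merged into one kernel-verified Lean document; each statement's English description precedes it below -/
import Mathlib

section
/- Let C(l) := sup_{k≥1} k^{2/l} e_k(N(0,I_l))². Let l_0, l ∈ ℕ with l ≥ l_0 and write l = n l_0 + m with n ∈ ℕ and m ∈ {0, …, l_0 − 1}. Then C(l) ≤ 4^{1/l_0} n C(l_0) + 4 m C(1). -/
open MeasureTheory ProbabilityTheory Real Filter

noncomputable section

/-- Minimal `n`-th `L²` quantization error of a probability measure `μ` on a normed space. -/
def quantErrMeas {E : Type*} [NormedAddCommGroup E] [MeasurableSpace E]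
    (μ : Measure E) (n : ℕ) : ℝ :=
  sInf { r : ℝ | ∃ α : Finset E, α.Nonempty ∧ α.card ≤ n ∧
    r = (∫ x, (⨅ a : α, ‖x - (a : E)‖ ^ 2) ∂μ) ^ (1/2 : ℝ) }

/-- The standard Gaussian distribution `N(0, I_l)` on `ℝ^l` with the Euclidean norm. -/
def stdGaussian (l : ℕ) : Measure (EuclideanSpace ℝ (Fin l)) :=
  (Measure.pi fun _ : Fin l => gaussianReal 0 1).map (EuclideanSpace.equiv (Fin l) ℝ).symm

/-- `C(l) := sup_{k ≥ 1} k^{2/l} e_k(N(0,I_l))²`. -/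
def Cconst (l : ℕ) : ℝ :=
  sSup { x : ℝ | ∃ k : ℕ, 1 ≤ k ∧
    x = (k : ℝ) ^ (2 / (l : ℝ)) * (quantErrMeas (stdGaussian l) k) ^ 2 }

/-- There is a nonempty quantizer of `N(0, I_d)` with at most `k` points and mean squared error
at most `c`. -/
def HasQuantizer (d k : ℕ) (c : ℝ) : Prop :=
  ∃ α : Finset (EuclideanSpace ℝ (Fin d)), α.Nonempty ∧ α.card ≤ k ∧
    ∫ x, (⨅ a : α, ‖x - (a : EuclideanSpace ℝ (Fin d))‖ ^ 2) ∂(_root_.stdGaussian d) ≤ c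

lemma iInf_norm_sub_sq_nonneg {E : Type*} [NormedAddCommGroup E] (α : Finset E) (x : E) :
    0 ≤ ⨅ a : α, ‖x - (a : E)‖ ^ 2 :=
  Real.iInf_nonneg fun _ => sq_nonneg _

lemma iInf_norm_sub_sq_le {E : Type*} [NormedAddCommGroup E] {α : Finset E} {a : E}
    (ha : a ∈ α) (x : E) : ⨅ a : α, ‖x - (a : E)‖ ^ 2 ≤ ‖x - a‖ ^ 2 :=
  ciInf_le (f := fun a : α => ‖x - (a : E)‖ ^ 2)
    ⟨0, by rintro _ ⟨b, rfl⟩; exact sq_nonneg _⟩ ⟨a, ha⟩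

lemma exists_iInf_norm_sub_sq_eq {E : Type*} [NormedAddCommGroup E] {α : Finset E}
    (hα : α.Nonempty) (x : E) : ∃ a ∈ α, ⨅ a : α, ‖x - (a : E)‖ ^ 2 = ‖x - a‖ ^ 2 := by
  have := hα.to_subtype
  obtain ⟨a, ha⟩ := exists_eq_ciInf_of_finite (f := fun a : α => ‖x - (a : E)‖ ^ 2)
  exact ⟨a, a.2, ha.symm⟩

lemma integrable_eval_stdGaussian (d : ℕ) (i : Fin d) {f : ℝ → ℝ}
    (hf : Integrable f (gaussianReal 0 1)) :
    Integrable (fun x : EuclideanSpace ℝ (Fin d) => f (x i)) (_root_.stdGaussian d) := by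
  unfold _root_.stdGaussian
  exact (EuclideanSpace.equiv (Fin d) ℝ).symm.toHomeomorph.measurableEmbedding.integrable_map_iff.2
    ((measurePreserving_eval (fun _ : Fin d => gaussianReal 0 1) i).integrable_comp_of_integrable hf)

lemma integrable_norm_sub_sq_stdGaussian (d : ℕ) (a : EuclideanSpace ℝ (Fin d)) :
    Integrable (fun x => ‖x - a‖ ^ 2) (_root_.stdGaussian d) := by
  simp_rw [EuclideanSpace.norm_sq_eq, Real.norm_eq_abs, sq_abs]
  refine integrable_finsetSum _ fun i _ => ?_
  refine integrable_eval_stdGaussian d i (f := fun t => (t - a i) ^ 2) ?_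
  exact (MemLp.sub (memLp_id_gaussianReal 2) (memLp_const (a i))).integrable_sq

lemma integrable_iInf_norm_sub_sq_stdGaussian (d : ℕ) {α : Finset (EuclideanSpace ℝ (Fin d))}
    (hα : α.Nonempty) :
    Integrable (fun x => ⨅ a : α, ‖x - (a : EuclideanSpace ℝ (Fin d))‖ ^ 2)
      (_root_.stdGaussian d) := by
  obtain ⟨a, ha⟩ := hα
  refine (integrable_norm_sub_sq_stdGaussian d a).mono'
    (Measurable.iInf fun i => by fun_prop).aestronglyMeasurable (Eventually.of_forall fun x => ?_)
  rw [Real.norm_of_nonneg (iInf_norm_sub_sq_nonneg α x)]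
  exact iInf_norm_sub_sq_le ha x

lemma map_castAdd_pi_gaussianReal (d e : ℕ) :
    (Measure.pi fun _ : Fin (d + e) => gaussianReal 0 1).map (fun x i => x (Fin.castAdd e i)) =
      Measure.pi fun _ : Fin d => gaussianReal 0 1 := by
  symm
  refine Measure.pi_eq fun s hs => ?_
  rw [Measure.map_apply (by fun_prop) (MeasurableSet.univ_pi hs)]
  have : (fun (x : Fin (d + e) → ℝ) (i : Fin d) => x (Fin.castAdd e i)) ⁻¹' Set.univ.pi s =
      Set.univ.pi (Fin.append s fun _ : Fin e => Set.univ) := by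
    ext x
    simp [Set.mem_pi, Fin.forall_fin_add]
  rw [this, Measure.pi_pi, Fin.prod_univ_add]
  simp

lemma map_natAdd_pi_gaussianReal (d e : ℕ) :
    (Measure.pi fun _ : Fin (d + e) => gaussianReal 0 1).map (fun x i => x (Fin.natAdd d i)) =
      Measure.pi fun _ : Fin e => gaussianReal 0 1 := by
  symm
  refine Measure.pi_eq fun s hs => ?_
  rw [Measure.map_apply (by fun_prop) (MeasurableSet.univ_pi hs)]
  have : (fun (x : Fin (d + e) → ℝ) (i : Fin e) => x (Fin.natAdd d i)) ⁻¹' Set.univ.pi s =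
      Set.univ.pi (Fin.append (fun _ : Fin d => Set.univ) s) := by
    ext x
    simp [Set.mem_pi, Fin.forall_fin_add]
  rw [this, Measure.pi_pi, Fin.prod_univ_add]
  simp

/-- The first `d` coordinates of a vector in `ℝ^(d+e)`. -/
def headCoords (d e : ℕ) (x : EuclideanSpace ℝ (Fin (d + e))) : EuclideanSpace ℝ (Fin d) :=
  WithLp.toLp 2 fun i => x (Fin.castAdd e i)

/-- The last `e` coordinates of a vector in `ℝ^(d+e)`. -/
def tailCoords (d e : ℕ) (x : EuclideanSpace ℝ (Fin (d + e))) : EuclideanSpace ℝ (Fin e) :=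
  WithLp.toLp 2 fun i => x (Fin.natAdd d i)

/-- Concatenation of a vector in `ℝ^d` and a vector in `ℝ^e`. -/
def appendCoords {d e : ℕ} (a : EuclideanSpace ℝ (Fin d)) (b : EuclideanSpace ℝ (Fin e)) :
    EuclideanSpace ℝ (Fin (d + e)) :=
  WithLp.toLp 2 (Fin.append a b)

lemma norm_sub_appendCoords_sq {d e : ℕ} (x : EuclideanSpace ℝ (Fin (d + e)))
    (a : EuclideanSpace ℝ (Fin d)) (b : EuclideanSpace ℝ (Fin e)) :
    ‖x - appendCoords a b‖ ^ 2 = ‖headCoords d e x - a‖ ^ 2 + ‖tailCoords d e x - b‖ ^ 2 := by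
  simp [EuclideanSpace.norm_sq_eq, Fin.sum_univ_add, appendCoords, headCoords, tailCoords]

lemma measurePreserving_headCoords (d e : ℕ) :
    MeasurePreserving (headCoords d e) (_root_.stdGaussian (d + e)) (_root_.stdGaussian d) := by
  have hm : Measurable (headCoords d e) := by unfold headCoords; fun_prop
  refine ⟨hm, ?_⟩
  unfold _root_.stdGaussian
  rw [← map_castAdd_pi_gaussianReal d e, Measure.map_map hm (by fun_prop),
    Measure.map_map (by fun_prop) (by fun_prop)]
  rfl

lemma measurePreserving_tailCoords (d e : ℕ) :
    MeasurePreserving (tailCoords d e) (_root_.stdGaussian (d + e)) (_root_.stdGaussian e) := by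
  have hm : Measurable (tailCoords d e) := by unfold tailCoords; fun_prop
  refine ⟨hm, ?_⟩
  unfold _root_.stdGaussian
  rw [← map_natAdd_pi_gaussianReal d e, Measure.map_map hm (by fun_prop),
    Measure.map_map (by fun_prop) (by fun_prop)]
  rfl

lemma HasQuantizer.mono {d k k' : ℕ} {c : ℝ} (h : HasQuantizer d k c) (hk : k ≤ k') :
    HasQuantizer d k' c := by
  obtain ⟨α, h1, h2, h3⟩ := h
  exact ⟨α, h1, h2.trans hk, h3⟩

/-- Product quantizers: sizes multiply and mean squared errors add. -/
lemma HasQuantizer.add {d e k k' : ℕ} {c c' : ℝ} (h : HasQuantizer d k c)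
    (h' : HasQuantizer e k' c') : HasQuantizer (d + e) (k * k') (c + c') := by
  classical
  obtain ⟨α, hα, hαk, hαc⟩ := h
  obtain ⟨β, hβ, hβk, hβc⟩ := h'
  refine ⟨(α ×ˢ β).image fun p => appendCoords p.1 p.2, (hα.product hβ).image _,
    Finset.card_image_le.trans ?_, ?_⟩
  · rw [Finset.card_product]
    exact Nat.mul_le_mul hαk hβk
  · have hiα := integrable_iInf_norm_sub_sq_stdGaussian d hα
    have hiβ := integrable_iInf_norm_sub_sq_stdGaussian e hβ
    have hpα := measurePreserving_headCoords d e
    have hpβ := measurePreserving_tailCoords d e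
    have hjα := hpα.integrable_comp_of_integrable hiα
    have hjβ := hpβ.integrable_comp_of_integrable hiβ
    have heα := integral_map (μ := _root_.stdGaussian (d + e)) hpα.measurable.aemeasurable
      (hpα.map_eq.symm ▸ hiα.aestronglyMeasurable)
    have heβ := integral_map (μ := _root_.stdGaussian (d + e)) hpβ.measurable.aemeasurable
      (hpβ.map_eq.symm ▸ hiβ.aestronglyMeasurable)
    rw [hpα.map_eq] at heα
    rw [hpβ.map_eq] at heβ
    rw [heα] at hαc
    rw [heβ] at hβc
    refine le_trans ?_ (add_le_add hαc hβc)
    refine le_of_le_of_eq ?_ (integral_add hjα hjβ)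
    refine integral_mono_of_nonneg (Eventually.of_forall fun x => iInf_norm_sub_sq_nonneg _ x)
      (hjα.add hjβ) (Eventually.of_forall fun x => ?_)
    obtain ⟨a, ha, hxa⟩ := exists_iInf_norm_sub_sq_eq hα (headCoords d e x)
    obtain ⟨b, hb, hxb⟩ := exists_iInf_norm_sub_sq_eq hβ (tailCoords d e x)
    dsimp only [Function.comp_apply]
    rw [hxa, hxb, ← norm_sub_appendCoords_sq]
    exact iInf_norm_sub_sq_le
      (Finset.mem_image.2 ⟨(a, b), Finset.mk_mem_product ha hb, rfl⟩) x

lemma hasQuantizer_zero : HasQuantizer 0 1 0 := by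
  refine ⟨{0}, by simp, by simp, le_of_eq ?_⟩
  refine integral_eq_zero_of_ae (Eventually.of_forall fun x => ?_)
  refine le_antisymm ?_ (iInf_norm_sub_sq_nonneg _ x)
  refine (iInf_norm_sub_sq_le (Finset.mem_singleton_self 0) x).trans ?_
  simp [Subsingleton.elim x 0]

lemma HasQuantizer.mul {d k : ℕ} {c : ℝ} (h : HasQuantizer d k c) (n : ℕ) :
    HasQuantizer (n * d) (k ^ n) (n * c) := by
  induction n with
  | zero => simpa using hasQuantizer_zero
  | succ n ih =>
    have := ih.add h
    rw [Nat.succ_mul, pow_succ]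
    convert this using 1
    push_cast
    ring

lemma HasQuantizer.quantErrMeas_sq_le {d k : ℕ} {c : ℝ} (h : HasQuantizer d k c) :
    quantErrMeas (_root_.stdGaussian d) k ^ 2 ≤ c := by
  obtain ⟨α, hα, hk, hc⟩ := h
  have hbdd : ∀ r ∈ { r : ℝ | ∃ α : Finset (EuclideanSpace ℝ (Fin d)), α.Nonempty ∧ α.card ≤ k ∧
      r = (∫ x, (⨅ a : α, ‖x - (a : EuclideanSpace ℝ (Fin d))‖ ^ 2) ∂(_root_.stdGaussian d)) ^
        (1 / 2 : ℝ) }, 0 ≤ r := by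
    rintro _ ⟨β, -, -, rfl⟩
    exact Real.rpow_nonneg (integral_nonneg fun x => iInf_norm_sub_sq_nonneg β x) _
  refine le_trans ?_ hc
  have h0 : 0 ≤ ∫ x, (⨅ a : α, ‖x - (a : EuclideanSpace ℝ (Fin d))‖ ^ 2) ∂(_root_.stdGaussian d) :=
    integral_nonneg fun x => iInf_norm_sub_sq_nonneg α x
  calc quantErrMeas (_root_.stdGaussian d) k ^ 2
      ≤ ((∫ x, (⨅ a : α, ‖x - (a : EuclideanSpace ℝ (Fin d))‖ ^ 2) ∂(_root_.stdGaussian d)) ^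
        (1 / 2 : ℝ)) ^ 2 :=
        pow_le_pow_left₀ (Real.sInf_nonneg hbdd) (csInf_le ⟨0, hbdd⟩ ⟨α, hα, hk, rfl⟩) 2
    _ = _ := by rw [← Real.sqrt_eq_rpow, Real.sq_sqrt h0]

lemma hasQuantizer_of_quantErrMeas_sq_lt {d k : ℕ} {c : ℝ} (hk : 1 ≤ k)
    (h : quantErrMeas (_root_.stdGaussian d) k ^ 2 < c) : HasQuantizer d k c := by
  have hlt : quantErrMeas (_root_.stdGaussian d) k < √c := Real.lt_sqrt_of_sq_lt h
  obtain ⟨_, ⟨α, hα, hαk, rfl⟩, hr⟩ :=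
    exists_lt_of_csInf_lt (by exact ⟨_, {0}, by simp, by simpa using hk, rfl⟩) hlt
  refine ⟨α, hα, hαk, ?_⟩
  rw [← Real.sqrt_eq_rpow] at hr
  exact (Real.sqrt_lt_sqrt_iff (integral_nonneg fun x => iInf_norm_sub_sq_nonneg α x)).1 hr |>.le

/-- The set whose supremum is `Cconst d`. -/
def scaledErrors (d : ℕ) : Set ℝ :=
  { x : ℝ | ∃ k : ℕ, 1 ≤ k ∧
    x = (k : ℝ) ^ (2 / (d : ℝ)) * (quantErrMeas (_root_.stdGaussian d) k) ^ 2 }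

lemma half_le_floor {x : ℝ} (hx : 1 ≤ x) : x / 2 ≤ (⌊x⌋₊ : ℝ) := by
  have h1 : (1 : ℝ) ≤ (⌊x⌋₊ : ℝ) := by exact_mod_cast Nat.one_le_floor_iff x |>.2 hx
  linarith [Nat.lt_floor_add_one x]

/-- If `Cconst d` is finite, `⌊k^{d/l}⌋` points in dimension `d` achieve a mean squared error of
at most `4^{1/d} C(d) k^{-2/l}`, up to an arbitrarily small `ε`. -/
lemma hasQuantizer_floor_rpow {d l k : ℕ} (hd : 1 ≤ d) (hk : 1 ≤ k)
    (hbdd : BddAbove (scaledErrors d)) {ε : ℝ} (hε : 0 < ε) :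
    HasQuantizer d ⌊(k : ℝ) ^ ((d : ℝ) / l)⌋₊
      (4 ^ (1 / (d : ℝ)) * Cconst d * (k : ℝ) ^ (-(2 / (l : ℝ))) + ε) := by
  have hd' : (d : ℝ) ≠ 0 := by positivity
  have hk' : (1 : ℝ) ≤ k := by exact_mod_cast hk
  set y : ℝ := (k : ℝ) ^ ((d : ℝ) / l) with hy
  have hy1 : 1 ≤ y := Real.one_le_rpow hk' (by positivity)
  have hf1 : 1 ≤ ⌊y⌋₊ := (Nat.one_le_floor_iff y).2 hy1
  refine hasQuantizer_of_quantErrMeas_sq_lt hf1 (lt_of_le_of_lt ?_ (lt_add_of_pos_right _ hε))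
  set q := quantErrMeas (_root_.stdGaussian d) ⌊y⌋₊ ^ 2
  have hq : 0 ≤ q := sq_nonneg _
  have hC : (⌊y⌋₊ : ℝ) ^ (2 / (d : ℝ)) * q ≤ Cconst d := le_csSup hbdd ⟨_, hf1, rfl⟩
  have hpow : (y / 2) ^ (2 / (d : ℝ)) ≤ (⌊y⌋₊ : ℝ) ^ (2 / (d : ℝ)) :=
    Real.rpow_le_rpow (by positivity) (half_le_floor hy1) (by positivity)
  have hyd : y ^ (2 / (d : ℝ)) = (k : ℝ) ^ (2 / (l : ℝ)) := by
    rw [hy, ← Real.rpow_mul (by positivity)]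
    congr 1
    field_simp
  have h2 : (2 : ℝ) ^ (2 / (d : ℝ)) = 4 ^ (1 / (d : ℝ)) := by
    rw [show (4 : ℝ) = 2 ^ (2 : ℝ) by norm_num, ← Real.rpow_mul (by norm_num)]
    congr 1
    ring
  rw [Real.div_rpow (by positivity) (by norm_num), hyd, h2] at hpow
  have h := (mul_le_mul_of_nonneg_right hpow hq).trans hC
  have hkp : 0 < (k : ℝ) ^ (2 / (l : ℝ)) := by positivity
  have h4 : (0 : ℝ) < 4 ^ (1 / (d : ℝ)) := by positivity
  rw [Real.rpow_neg (by positivity), ← div_eq_mul_inv, le_div_iff₀ hkp]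
  rw [div_mul_eq_mul_div, div_le_iff₀ h4] at h
  linarith

lemma scaledErrors_le {d l n m : ℕ} (hd : 1 ≤ d) (hl : 1 ≤ l) (hdecomp : l = n * d + m)
    (hbdd : BddAbove (scaledErrors d)) (hbdd1 : BddAbove (scaledErrors 1)) :
    ∀ x ∈ scaledErrors l, x ≤ 4 ^ (1 / (d : ℝ)) * n * Cconst d + 4 * m * Cconst 1 := by
  rintro _ ⟨k, hk, rfl⟩
  have hkp : 0 < (k : ℝ) ^ (2 / (l : ℝ)) := by positivity
  have hl' : (l : ℝ) ≠ 0 := by positivity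
  have hcard : ⌊(k : ℝ) ^ ((d : ℝ) / l)⌋₊ ^ n * ⌊(k : ℝ) ^ (((1 : ℕ) : ℝ) / l)⌋₊ ^ m ≤ k := by
    have : ((⌊(k : ℝ) ^ ((d : ℝ) / l)⌋₊ ^ n * ⌊(k : ℝ) ^ (((1 : ℕ) : ℝ) / l)⌋₊ ^ m : ℕ) : ℝ) ≤
        (k : ℝ) := by
      push_cast
      calc _ ≤ ((k : ℝ) ^ ((d : ℝ) / l)) ^ n * ((k : ℝ) ^ ((1 : ℝ) / l)) ^ m := by
            gcongr <;> exact Nat.floor_le (by positivity)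
        _ = (k : ℝ) ^ (1 : ℝ) := by
            rw [← Real.rpow_mul_natCast (by positivity), ← Real.rpow_mul_natCast (by positivity),
              ← Real.rpow_add (by positivity)]
            congr 1
            field_simp
            rw [hdecomp]
            push_cast
            ring
        _ = k := Real.rpow_one _
    exact_mod_cast this
  set A := 4 ^ (1 / (d : ℝ)) * Cconst d
  set B := 4 ^ (1 / ((1 : ℕ) : ℝ)) * Cconst 1 with hB
  have hle : quantErrMeas (_root_.stdGaussian l) k ^ 2 ≤
      (n * A + m * B) * (k : ℝ) ^ (-(2 / (l : ℝ))) := by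
    refine le_of_forall_pos_le_add fun ε hε => ?_
    have hδ : 0 < ε / (n + m + 1) := by positivity
    have h1 := (hasQuantizer_floor_rpow (l := l) hd hk hbdd hδ).mul n
    have h2 := (hasQuantizer_floor_rpow (l := l) le_rfl hk hbdd1 hδ).mul m
    have h3 := h1.add h2
    rw [mul_one, ← hdecomp] at h3
    refine (h3.mono hcard).quantErrMeas_sq_le.trans ?_
    have : (n + m) * (ε / (n + m + 1)) ≤ ε := by
      rw [mul_div_assoc', div_le_iff₀ (by positivity)]
      nlinarith
    set δ := ε / (n + m + 1 : ℝ)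
    change n * (A * (k : ℝ) ^ (-(2 / (l : ℝ))) + δ) + m * (B * (k : ℝ) ^ (-(2 / (l : ℝ))) + δ) ≤ _
    linarith
  rw [Real.rpow_neg (by positivity), ← div_eq_mul_inv, le_div_iff₀ hkp] at hle
  rw [mul_comm]
  refine hle.trans (le_of_eq ?_)
  simp [A, hB]
  ring

/-- Pull-back of the uniform grid on `(-1, 1)` under `x ↦ x / (1 + |x|)`: every real `x` is within
`(1 + |x|)² / N` of one of these points. -/
lemma exists_int_abs_sub_le {N : ℕ} (hN : 1 ≤ N) (x : ℝ) :
    ∃ j ∈ Finset.Ioo (-(N : ℤ)) N, |x - j / (N - |(j : ℝ)|)| ≤ (1 + |x|) ^ 2 / N := by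
  have key : ∀ x : ℝ, 0 ≤ x → ∃ j : ℕ, j < N ∧ |x - j / (N - (j : ℝ))| ≤ (1 + x) ^ 2 / N := by
    intro x hx
    have hN' : (0 : ℝ) < N := by positivity
    have hu : 0 ≤ N * (x / (1 + x)) := by positivity
    have h1 := Nat.floor_le hu
    have h2 := Nat.lt_floor_add_one (N * (x / (1 + x)))
    set j := ⌊N * (x / (1 + x))⌋₊
    have hx1 : (0 : ℝ) < 1 + x := by positivity
    rw [mul_div_assoc', le_div_iff₀ hx1] at h1
    rw [mul_div_assoc', div_lt_iff₀ hx1] at h2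
    have hjN : (j : ℝ) < N := by nlinarith
    have hpos : 0 < (N : ℝ) - j := by linarith
    refine ⟨j, by exact_mod_cast hjN, ?_⟩
    have hNj : (N : ℝ) ≤ (N - j) * (1 + x) := by nlinarith
    have heq : x - j / (N - (j : ℝ)) = (N * x - j * (1 + x)) / (N - j) := by
      field_simp
      ring
    rw [heq, abs_of_nonneg (div_nonneg (by linarith) hpos.le), div_le_div_iff₀ hpos hN']
    have h3 : N * x - j * (1 + x) ≤ 1 + x := by linarith
    calc (N * x - j * (1 + x)) * N ≤ (1 + x) * ((N - j) * (1 + x)) := by gcongr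
      _ = _ := by ring
  obtain ⟨j, hj, hle⟩ := key |x| (abs_nonneg x)
  rcases le_total 0 x with hx | hx
  · refine ⟨j, by simp; omega, ?_⟩
    rw [abs_of_nonneg hx] at hle ⊢
    simpa using hle
  · refine ⟨-j, by simp; omega, ?_⟩
    rw [abs_of_nonpos hx] at hle ⊢
    rw [← abs_neg]
    convert hle using 2
    simp
    ring

lemma integrable_one_add_abs_pow_four_gaussianReal :
    Integrable (fun t : ℝ => (1 + |t|) ^ 4) (gaussianReal 0 1) := by
  have h1 : MemLp (fun t : ℝ => |t|) ((4 : ℕ) : ENNReal) (gaussianReal 0 1) :=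
    (memLp_id_gaussianReal' _ (ENNReal.natCast_ne_top 4)).abs
  have h : MemLp (fun t : ℝ => 1 + |t|) ((4 : ℕ) : ENNReal) (gaussianReal 0 1) :=
    (memLp_const (1 : ℝ)).add h1
  refine (h.integrable_norm_pow (by norm_num)).congr (Eventually.of_forall fun t => ?_)
  simp only [Real.norm_of_nonneg (show 0 ≤ 1 + |t| by positivity)]

/-- The companded grid as points of `ℝ^1`. -/
def compandedPoint (N : ℕ) (j : ℤ) : EuclideanSpace ℝ (Fin 1) :=
  WithLp.toLp 2 fun _ => (j : ℝ) / (N - |(j : ℝ)|)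

lemma hasQuantizer_one {N : ℕ} (hN : 1 ≤ N) :
    HasQuantizer 1 (2 * N - 1)
      ((∫ x : EuclideanSpace ℝ (Fin 1), (1 + |x 0|) ^ 4 ∂(_root_.stdGaussian 1)) / N ^ 2) := by
  classical
  have hint : Integrable (fun x : EuclideanSpace ℝ (Fin 1) => (1 + |x 0|) ^ 4)
      (_root_.stdGaussian 1) :=
    integrable_eval_stdGaussian 1 0 (f := fun t => (1 + |t|) ^ 4)
      integrable_one_add_abs_pow_four_gaussianReal
  refine ⟨(Finset.Ioo (-(N : ℤ)) N).image (compandedPoint N),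
    Finset.Nonempty.image ⟨0, by simp; omega⟩ _, Finset.card_image_le.trans ?_, ?_⟩
  · rw [Int.card_Ioo]
    omega
  · rw [← integral_div]
    refine integral_mono_of_nonneg (Eventually.of_forall fun x => iInf_norm_sub_sq_nonneg _ x)
      (hint.div_const _) (Eventually.of_forall fun x => ?_)
    obtain ⟨j, hj, hle⟩ := exists_int_abs_sub_le hN (x 0)
    refine (iInf_norm_sub_sq_le (Finset.mem_image_of_mem _ hj) x).trans ?_
    rw [EuclideanSpace.norm_sq_eq, Fin.sum_univ_one, PiLp.sub_apply, Real.norm_eq_abs]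
    refine (pow_le_pow_left₀ (abs_nonneg _) hle 2).trans (le_of_eq ?_)
    rw [div_pow, ← pow_mul]

lemma bddAbove_scaledErrors_one : BddAbove (scaledErrors 1) := by
  refine ⟨4 * ∫ x : EuclideanSpace ℝ (Fin 1), (1 + |x 0|) ^ 4 ∂(_root_.stdGaussian 1), ?_⟩
  rintro _ ⟨k, hk, rfl⟩
  obtain ⟨N, hN1, hN2, hN3⟩ : ∃ N : ℕ, 1 ≤ N ∧ 2 * N - 1 ≤ k ∧ k ≤ 2 * N :=
    ⟨(k + 1) / 2, by omega, by omega, by omega⟩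
  have hq := ((hasQuantizer_one hN1).mono hN2).quantErrMeas_sq_le
  generalize ∫ x : EuclideanSpace ℝ (Fin 1), (1 + |x 0|) ^ 4 ∂(_root_.stdGaussian 1) = M at hq ⊢
  have hN0 : (0 : ℝ) < N := by positivity
  have hkN : (k : ℝ) ≤ 2 * N := by exact_mod_cast hN3
  calc (k : ℝ) ^ (2 / ((1 : ℕ) : ℝ)) * quantErrMeas (_root_.stdGaussian 1) k ^ 2
      = (k : ℝ) ^ 2 * quantErrMeas (_root_.stdGaussian 1) k ^ 2 := by simp
    _ ≤ (2 * N) ^ 2 * (M / N ^ 2) := by gcongr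
    _ = 4 * M := by
        field_simp
        ring

/-- Writing `l = n l₀ + m` with `0 ≤ m < l₀ ≤ l`, one has
`C(l) ≤ 4^{1/l₀} n C(l₀) + 4 m C(1)`. -/
theorem Cconst_block_inequality
    (l₀ l n m : ℕ) (hl₀ : 1 ≤ l₀) (hl : l₀ ≤ l)
    (hdecomp : l = n * l₀ + m) (hm : m < l₀) :
    Cconst l ≤ 4 ^ (1 / (l₀ : ℝ)) * n * Cconst l₀ + 4 * m * Cconst 1 := by
  have hbdd : BddAbove (scaledErrors l₀) :=
    ⟨_, scaledErrors_le (n := l₀) (m := 0) le_rfl hl₀ (by simp) bddAbove_scaledErrors_one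
      bddAbove_scaledErrors_one⟩
  exact csSup_le ⟨_, 1, le_rfl, rfl⟩
    (scaledErrors_le hl₀ (hl₀.trans hl) hdecomp hbdd bddAbove_scaledErrors_one)
end
end

section
/- Let φ : (s, ∞) → (0, ∞) (s ≥ 0) be a decreasing function, regularly varying at infinity of index −b with b > 1, and let λ_j := φ(j) for large j be nonincreasing positive reals with λ_j ∼ φ(j) as j → ∞. For n, l ∈ ℕ set m(n,l) := max{k ≥ 1 : n^{1/k} λ_{(k−1)l+1}^{l/2} (Π_{j=1}^k λ_{(j−1)l+1})^{−l/2k} ≥ 1}, and set l_n := [(max{1, log n})^θ] for a fixed θ ∈ (0,1). Then m(n, l_n) · l_n ∼ (2 log n)/b as n → ∞. -/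
open MeasureTheory ProbabilityTheory Real Filter

noncomputable section

/-- A sequence `a` varies like `b * log` if `a (N n) - a (i n) → -b * log x` whenever
`N n → ∞` and `i n / N n → x > 0`. -/
def VariesLikeLog (a : ℕ → ℝ) (b : ℝ) : Prop :=
  ∀ (i N : ℕ → ℕ) (x : ℝ), 0 < x → Tendsto N atTop atTop →
    Tendsto (fun n => (i n : ℝ) / N n) atTop (nhds x) →
    Tendsto (fun n => a (N n) - a (i n)) atTop (nhds (-b * log x))

/-- The regular variation limit of a monotone function is locally uniform. -/
lemma tendsto_div_of_regularlyVarying {s b : ℝ} {φ : ℝ → ℝ}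
    (hφpos : ∀ x, s < x → 0 < φ x) (hφdec : AntitoneOn φ (Set.Ioi s))
    (hφrv : ∀ c : ℝ, 0 < c →
      Tendsto (fun x : ℝ => φ (c * x) / φ x) atTop (nhds (c ^ (-b))))
    {u v : ℕ → ℝ} {x : ℝ} (hx : 0 < x) (hv : Tendsto v atTop atTop)
    (huv : Tendsto (fun n => u n / v n) atTop (nhds x)) :
    Tendsto (fun n => φ (u n) / φ (v n)) atTop (nhds (x ^ (-b))) := by
  have hcont : ContinuousAt (fun y : ℝ => y ^ (-b)) x :=
    continuousAt_rpow_const x (-b) (Or.inl hx.ne')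
  have hv0 : ∀ᶠ n in atTop, 0 < v n ∧ s < v n :=
    (hv.eventually_gt_atTop 0).and (hv.eventually_gt_atTop s)
  have hmul : ∀ y : ℝ, 0 < y → ∀ᶠ n in atTop, s < y * v n := fun y hy =>
    (hv.const_mul_atTop hy).eventually_gt_atTop s
  rw [tendsto_order]
  constructor
  · intro r hr
    have h1 : ∀ᶠ y in nhdsWithin x (Set.Ioi x), r < y ^ (-b) :=
      (hcont.eventually (lt_mem_nhds hr)).filter_mono nhdsWithin_le_nhds
    obtain ⟨z, hz, hxz⟩ := (h1.and self_mem_nhdsWithin).exists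
    have hxz : x < z := hxz
    filter_upwards [hv0, (hφrv z (hx.trans hxz)).comp hv |>.eventually (lt_mem_nhds hz),
      huv.eventually (gt_mem_nhds hxz), huv.eventually (lt_mem_nhds (half_lt_self hx)),
      hmul (x / 2) (half_pos hx), hmul z (hx.trans hxz)] with n hn h2 h3 h4 h5 h6
    rw [div_lt_iff₀ hn.1] at h3
    rw [lt_div_iff₀ hn.1] at h4
    have := hφpos _ hn.2
    exact h2.trans_le (div_le_div_of_nonneg_right
      (hφdec (h5.trans h4 : s < u n) h6 h3.le) this.le)
  · intro r hr
    have h1 : ∀ᶠ y in nhdsWithin x (Set.Iio x), y ^ (-b) < r ∧ 0 < y :=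
      ((hcont.eventually (gt_mem_nhds hr)).and (lt_mem_nhds hx)).filter_mono nhdsWithin_le_nhds
    obtain ⟨z, ⟨hz, hz0⟩, hxz⟩ := (h1.and self_mem_nhdsWithin).exists
    have hxz : z < x := hxz
    filter_upwards [hv0, (hφrv z hz0).comp hv |>.eventually (gt_mem_nhds hz),
      huv.eventually (lt_mem_nhds hxz), hmul z hz0] with n hn h2 h3 h4
    rw [lt_div_iff₀ hn.1] at h3
    have := hφpos _ hn.2
    exact (div_le_div_of_nonneg_right
      (hφdec h4 (h4.trans h3 : s < u n) h3.le) this.le).trans_lt h2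

lemma variesLikeLog_neg_log {s b : ℝ} {φ : ℝ → ℝ}
    (hφpos : ∀ x, s < x → 0 < φ x) (hφdec : AntitoneOn φ (Set.Ioi s))
    (hφrv : ∀ c : ℝ, 0 < c →
      Tendsto (fun x : ℝ => φ (c * x) / φ x) atTop (nhds (c ^ (-b))))
    {lam : ℕ → ℝ} (hlampos : ∀ j, 0 < lam j)
    (hlam : Tendsto (fun j : ℕ => lam j / φ j) atTop (nhds 1)) :
    VariesLikeLog (fun j => -log (lam j)) b := by
  intro i N x hx hN hiN
  have hNr : Tendsto (fun n => (N n : ℝ)) atTop atTop := tendsto_natCast_atTop_atTop.comp hN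
  have hir : Tendsto (fun n => (i n : ℝ)) atTop atTop := by
    refine (hiN.pos_mul_atTop hx hNr).congr' ?_
    filter_upwards [hNr.eventually_gt_atTop 0] with n hn
    exact div_mul_cancel₀ _ hn.ne'
  have hi : Tendsto i atTop atTop := tendsto_natCast_atTop_iff.mp hir
  have hratio := tendsto_div_of_regularlyVarying hφpos hφdec hφrv hx hNr hiN
  have h1 := ((hlam.comp hi).mul hratio).div (hlam.comp hN) one_ne_zero
  rw [one_mul, div_one] at h1
  have h2 := h1.log (rpow_pos_of_pos hx _).ne'
  rw [log_rpow hx] at h2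
  refine h2.congr' ?_
  filter_upwards [hNr.eventually_gt_atTop s, hir.eventually_gt_atTop s] with n h3 h4
  have h5 := hφpos _ h3
  have h6 := hφpos _ h4
  have h7 := hlampos (N n)
  have h8 := hlampos (i n)
  have : lam (i n) / φ (i n) * (φ (i n) / φ (N n)) / (lam (N n) / φ (N n))
      = lam (i n) / lam (N n) := by field_simp
  simp only [Function.comp, Pi.div_apply]
  rw [this, log_div h8.ne' h7.ne']
  ring

/-- Growth bound of Potter type. -/
lemma VariesLikeLog.exists_sub_le {a : ℕ → ℝ} {b : ℝ} (h : VariesLikeLog a b) (ha : Monotone a) :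
    ∃ C : ℝ, 0 ≤ C ∧ ∀ (i N : ℕ) (y : ℝ), 1 ≤ y → (N : ℝ) ≤ y * i →
      a N - a i ≤ C * (1 + logb 2 y) := by
  have h1 : Tendsto (fun n : ℕ => a (2 * n) - a n) atTop (nhds (-b * log (1 / 2))) := by
    refine h (fun n => n) (fun n => 2 * n) (1 / 2) (by norm_num)
      (tendsto_id.const_mul_atTop' two_pos) ?_
    refine tendsto_const_nhds.congr' ?_
    filter_upwards [eventually_gt_atTop 0] with n hn
    have : (n : ℝ) ≠ 0 := by positivity
    push_cast
    field_simp
  obtain ⟨C, hC⟩ := h1.bddAbove_range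
  have hC' : ∀ n, a (2 * n) - a n ≤ C := fun n => hC ⟨n, rfl⟩
  have hC0 : 0 ≤ C := (sub_nonneg.mpr (ha (by omega))).trans (hC' 0)
  have hpow : ∀ p i : ℕ, a (2 ^ p * i) - a i ≤ C * p := by
    intro p i
    induction p with
    | zero => simp
    | succ p ih =>
      have := hC' (2 ^ p * i)
      rw [← mul_assoc, ← pow_succ'] at this
      push_cast
      linarith
  refine ⟨C, hC0, fun i N y hy hN => ?_⟩
  have hlog : 0 ≤ logb 2 y := logb_nonneg one_lt_two hy
  have hyp : y ≤ 2 ^ ⌈logb 2 y⌉₊ := by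
    rw [← rpow_natCast, ← logb_le_iff_le_rpow one_lt_two (by linarith)]
    exact Nat.le_ceil _
  have hN' : N ≤ 2 ^ ⌈logb 2 y⌉₊ * i := by
    have : (N : ℝ) ≤ 2 ^ ⌈logb 2 y⌉₊ * i := hN.trans (by gcongr)
    exact_mod_cast this
  have h2 := ha hN'
  have h3 := hpow ⌈logb 2 y⌉₊ i
  have h4 : C * (⌈logb 2 y⌉₊ : ℝ) ≤ C * (1 + logb 2 y) :=
    mul_le_mul_of_nonneg_left (by linarith [Nat.ceil_lt_add_one hlog]) hC0
  linarith

/-- A normalised finite sum as the integral of a step function. -/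
lemma integral_step_function (f : ℕ → ℝ) {k : ℕ} (hk : 0 < k) :
    ∫ x in (0 : ℝ)..1, f (⌈(k : ℝ) * x⌉₊ - 1) = (∑ j ∈ Finset.range k, f j) / k := by
  have hk' : (k : ℝ) ≠ 0 := by positivity
  have heq : ∀ j : ℕ, ∀ x ∈ Set.uIoc (j : ℝ) ((j + 1 : ℕ) : ℝ), f j = f (⌈x⌉₊ - 1) := by
    intro j x hx
    rw [Set.uIoc_of_le (by push_cast; linarith)] at hx
    have : ⌈x⌉₊ = j + 1 := by
      rw [Nat.ceil_eq_iff (by omega)]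
      simpa using hx
    rw [this, Nat.add_sub_cancel]
  rw [intervalIntegral.integral_comp_mul_left (fun x => f (⌈x⌉₊ - 1)) hk', mul_zero, mul_one]
  have hsum := intervalIntegral.sum_integral_adjacent_intervals (μ := volume)
    (f := fun x : ℝ => f (⌈x⌉₊ - 1)) (a := fun j : ℕ => (j : ℝ)) (n := k) (fun j _ =>
      (intervalIntegrable_const (c := f j)).congr (heq j))
  rw [Nat.cast_zero] at hsum
  rw [← hsum, smul_eq_mul, div_eq_inv_mul]
  congr 1
  refine Finset.sum_congr rfl fun j _ => ?_
  rw [← intervalIntegral.integral_congr_ae (Eventually.of_forall (heq j))]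
  simp

/-- The total increment `∑_{j<k} (a ((k-1)l) - a (jl))`. -/
def blockIncrement (a : ℕ → ℝ) (l k : ℕ) : ℝ :=
  ∑ j ∈ Finset.range k, (a ((k - 1) * l) - a (j * l))

lemma monotone_blockIncrement {a : ℕ → ℝ} (ha : Monotone a) (l : ℕ) :
    Monotone (blockIncrement a l) := by
  refine monotone_nat_of_le_succ fun k => ?_
  unfold blockIncrement
  rw [Finset.sum_range_succ, Nat.add_sub_cancel, sub_self, add_zero]
  refine Finset.sum_le_sum fun j _ => ?_
  have := ha (Nat.mul_le_mul_right l (Nat.sub_le k 1))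
  linarith

lemma VariesLikeLog.tendsto_blockIncrement_div {a : ℕ → ℝ} {b : ℝ} (h : VariesLikeLog a b)
    (ha : Monotone a) {k l : ℕ → ℕ} (hk : Tendsto k atTop atTop) (hl : ∀ n, 1 ≤ l n)
    (hkl : Tendsto (fun n => log (l n) / k n) atTop (nhds 0)) :
    Tendsto (fun n => blockIncrement a (l n) (k n) / k n) atTop (nhds b) := by
  obtain ⟨C, hC0, hC⟩ := h.exists_sub_le ha
  have hkr : Tendsto (fun n => (k n : ℝ)) atTop atTop := tendsto_natCast_atTop_atTop.comp hk
  have hNtop : Tendsto (fun n => (k n - 1) * l n) atTop atTop :=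
    tendsto_atTop_mono (fun n => Nat.le_mul_of_pos_right _ (hl n))
      ((tendsto_sub_atTop_nat 1).comp hk)
  -- the leading term is negligible
  have hfirst : Tendsto (fun n => (a ((k n - 1) * l n) - a 0) / k n) atTop (nhds 0) := by
    have hlogk : Tendsto (fun n => log (k n) / k n) atTop (nhds 0) :=
      isLittleO_log_id_atTop.tendsto_div_nhds_zero.comp hkr
    have hup : Tendsto (fun n => (a 1 - a 0 + C) * (k n : ℝ)⁻¹
        + C / log 2 * (log (k n) / k n + log (l n) / k n)) atTop (nhds 0) := by
      simpa using ((hkr.inv_tendsto_atTop).const_mul (a 1 - a 0 + C)).add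
        ((hlogk.add hkl).const_mul (C / log 2))
    refine tendsto_of_tendsto_of_tendsto_of_le_of_le' tendsto_const_nhds hup
      (Eventually.of_forall fun n => ?_) ?_
    · exact div_nonneg (sub_nonneg.mpr (ha (Nat.zero_le _))) (Nat.cast_nonneg _)
    · filter_upwards [hk.eventually_ge_atTop 1] with n hn
      have hk1 : (1 : ℝ) ≤ k n := by exact_mod_cast hn
      have hl1 : (1 : ℝ) ≤ l n := by exact_mod_cast hl n
      have h1 := hC 1 ((k n - 1) * l n) (k n * l n) (one_le_mul_of_one_le_of_one_le hk1 hl1) (by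
        rw [Nat.cast_one, mul_one]
        exact_mod_cast Nat.mul_le_mul_right (l n) (Nat.sub_le (k n) 1))
      rw [logb, log_mul (by positivity) (by positivity)] at h1
      have h2 : (a 1 - a 0 + C) * (k n : ℝ)⁻¹ + C / log 2 * (log (k n) / k n + log (l n) / k n)
          = (a 1 - a 0 + C * (1 + (log (k n) + log (l n)) / log 2)) / k n := by
        field_simp
        ring
      rw [h2]
      gcongr
      linarith
  -- the remaining terms form a Riemann sum
  let f : ℕ → ℕ → ℝ := fun n j => if j = 0 then 0 else a ((k n - 1) * l n) - a (j * l n)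
  have hrest : Tendsto (fun n => ∫ x in (0 : ℝ)..1, f n (⌈(k n : ℝ) * x⌉₊ - 1)) atTop
      (nhds (∫ x in (0 : ℝ)..1, -b * log x)) := by
    refine intervalIntegral.tendsto_integral_filter_of_dominated_convergence
      (fun x => C * (1 + (log 2 - log x) / log 2)) ?_ ?_ ?_ ?_
    · refine Eventually.of_forall fun n => Measurable.aestronglyMeasurable ?_
      exact (measurable_from_nat (f := fun m => f n (m - 1))).comp
        (Nat.measurable_ceil.comp (measurable_const_mul _))
    · filter_upwards [hk.eventually_ge_atTop 1] with n hn
      refine Eventually.of_forall fun x hx => ?_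
      rw [Set.uIoc_of_le zero_le_one] at hx
      have hy : 1 ≤ 2 / x := by
        rw [le_div_iff₀ hx.1]
        linarith [hx.2]
      have hbound : C * (1 + (log 2 - log x) / log 2) = C * (1 + logb 2 (2 / x)) := by
        rw [logb, log_div two_ne_zero hx.1.ne']
      rw [hbound]
      have hlogb : 0 ≤ logb 2 (2 / x) := logb_nonneg one_lt_two hy
      simp only [f]
      split_ifs with h0
      · rw [norm_zero]
        positivity
      · have hk0 : (0 : ℝ) < k n := by exact_mod_cast hn
        have hceil : ⌈(k n : ℝ) * x⌉₊ ≤ k n := by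
          rw [Nat.ceil_le]
          nlinarith [hx.2]
        have hle : a ((⌈(k n : ℝ) * x⌉₊ - 1) * l n) ≤ a ((k n - 1) * l n) :=
          ha (Nat.mul_le_mul_right _ (Nat.sub_le_sub_right hceil 1))
        rw [norm_of_nonneg (sub_nonneg.mpr hle)]
        refine hC _ _ _ hy ?_
        have h1 : (k n : ℝ) * x ≤ 2 * ((⌈(k n : ℝ) * x⌉₊ - 1 : ℕ) : ℝ) := by
          refine (Nat.le_ceil _).trans ?_
          exact_mod_cast (by omega : ⌈(k n : ℝ) * x⌉₊ ≤ 2 * (⌈(k n : ℝ) * x⌉₊ - 1))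
        have h2 : ((k n - 1 : ℕ) : ℝ) ≤ k n := by exact_mod_cast Nat.sub_le (k n) 1
        push_cast
        rw [← mul_assoc]
        refine mul_le_mul_of_nonneg_right (h2.trans ?_) (Nat.cast_nonneg _)
        rw [div_mul_eq_mul_div, le_div_iff₀ hx.1]
        exact h1
    · exact ((intervalIntegrable_const.add ((intervalIntegrable_const.sub
        intervalIntegral.intervalIntegrable_log').div_const _)).const_mul _)
    · refine Eventually.of_forall fun x hx => ?_
      rw [Set.uIoc_of_le zero_le_one] at hx
      have hkx : Tendsto (fun n => (k n : ℝ) * x) atTop atTop := hkr.atTop_mul_const hx.1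
      have hratio : Tendsto (fun n => (((⌈(k n : ℝ) * x⌉₊ - 1) * l n : ℕ) : ℝ)
          / ((k n - 1) * l n : ℕ)) atTop (nhds x) := by
        have h1 : Tendsto (fun n => (⌈x * (k n : ℝ)⌉₊ : ℝ) / k n) atTop (nhds x) :=
          (tendsto_nat_ceil_mul_div_atTop hx.1.le).comp hkr
        have h2 : Tendsto (fun n => (k n : ℝ)⁻¹) atTop (nhds 0) := hkr.inv_tendsto_atTop
        have h3 := (h1.sub h2).div (h2.const_sub 1) (by norm_num)
        rw [sub_zero, sub_zero, div_one] at h3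
        refine h3.congr' ?_
        filter_upwards [hk.eventually_ge_atTop 2, hkx.eventually_gt_atTop 0] with n hn hn2
        have hl0 : (l n : ℝ) ≠ 0 := by exact_mod_cast (by have := hl n; omega : l n ≠ 0)
        have hk1 : (2 : ℝ) ≤ k n := by exact_mod_cast hn
        have hk2 : (k n : ℝ) - 1 ≠ 0 := by linarith
        have hc : 1 ≤ ⌈(k n : ℝ) * x⌉₊ := Nat.one_le_ceil_iff.mpr hn2
        simp only [Pi.div_apply]
        push_cast [Nat.cast_sub hc, Nat.cast_sub (by omega : 1 ≤ k n)]
        rw [mul_div_mul_right _ _ hl0, mul_comm x]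
        field_simp
      refine (h _ _ x hx.1 hNtop hratio).congr' ?_
      filter_upwards [hkx.eventually_gt_atTop 1] with n hn
      have : 1 < ⌈(k n : ℝ) * x⌉₊ := Nat.lt_ceil.mpr (by exact_mod_cast hn)
      simp only [f]
      rw [if_neg (by omega)]
  have hint : ∫ x in (0 : ℝ)..1, -b * log x = b := by
    rw [intervalIntegral.integral_const_mul, integral_log]
    simp
  rw [hint] at hrest
  have hsum := hfirst.add hrest
  rw [zero_add] at hsum
  refine hsum.congr' ?_
  filter_upwards [hk.eventually_ge_atTop 1] with n hn
  rw [integral_step_function (f n) hn, ← add_div]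
  congr 1
  obtain ⟨q, hq⟩ : ∃ q, k n = q + 1 := ⟨k n - 1, by omega⟩
  unfold blockIncrement
  rw [hq, Finset.sum_range_succ', Finset.sum_range_succ']
  simp only [f, hq]
  simp
  ring

/-- The defining inequality of the block number, after taking logarithms. -/
lemma one_le_block_iff {lam : ℕ → ℝ} (hlampos : ∀ j, 0 < lam j) {n k l : ℕ} (hn : 1 ≤ n)
    (hk : 1 ≤ k) :
    1 ≤ (n : ℝ) ^ (1 / (k : ℝ)) * (lam ((k - 1) * l)) ^ ((l : ℝ) / 2)
        * (∏ j ∈ Finset.range k, lam (j * l)) ^ (-(l : ℝ) / (2 * k)) ↔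
      (l : ℝ) * blockIncrement (fun j => -log (lam j)) l k ≤ 2 * log n := by
  have hn0 : (0 : ℝ) < n := by exact_mod_cast hn
  have hk0 : (0 : ℝ) < k := by exact_mod_cast hk
  have hP : 0 < ∏ j ∈ Finset.range k, lam (j * l) := Finset.prod_pos fun j _ => hlampos _
  have h1 := rpow_pos_of_pos hn0 (1 / (k : ℝ))
  have h2 := rpow_pos_of_pos (hlampos ((k - 1) * l)) ((l : ℝ) / 2)
  have h3 := rpow_pos_of_pos hP (-(l : ℝ) / (2 * k))
  rw [← log_nonneg_iff (by positivity), log_mul (by positivity) h3.ne', log_mul h1.ne' h2.ne',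
    log_rpow hn0, log_rpow (hlampos _), log_rpow hP, log_prod fun j _ => (hlampos _).ne']
  have hinc : blockIncrement (fun j => -log (lam j)) l k
      = ∑ j ∈ Finset.range k, log (lam (j * l)) - k * log (lam ((k - 1) * l)) := by
    simp only [blockIncrement, Finset.sum_sub_distrib, Finset.sum_neg_distrib, Finset.sum_const,
      Finset.card_range, nsmul_eq_mul]
    ring
  rw [hinc]
  set S := ∑ j ∈ Finset.range k, log (lam (j * l))
  have key : 1 / (k : ℝ) * log n + (l : ℝ) / 2 * log (lam ((k - 1) * l))
      + -(l : ℝ) / (2 * k) * S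
      = (2 * log n - l * (S - k * log (lam ((k - 1) * l)))) / (2 * k) := by
    field_simp
    ring
  rw [key, le_div_iff₀ (by positivity), zero_mul, sub_nonneg]

/-- Block lengths `⌊(log n)^θ⌋` satisfy `l n * log (l n) = o(log n)` and `l n = o(log n)`. -/
lemma blockLength_asymptotics {θ : ℝ} (hθ0 : 0 < θ) (hθ1 : θ < 1) {l : ℕ → ℕ}
    (hl : ∀ n : ℕ, l n = ⌊(max 1 (log n)) ^ θ⌋₊) :
    Tendsto (fun n : ℕ => (l n : ℝ) / log n) atTop (nhds 0) ∧
      Tendsto (fun n : ℕ => log (l n) * l n / log n) atTop (nhds 0) := by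
  have hL : Tendsto (fun n : ℕ => log n) atTop atTop :=
    tendsto_log_atTop.comp tendsto_natCast_atTop_atTop
  have hle : ∀ᶠ n : ℕ in atTop, 1 ≤ log n ∧ (1 : ℝ) ≤ l n ∧ (l n : ℝ) ≤ log n ^ θ := by
    filter_upwards [hL.eventually_ge_atTop 1] with n hn
    have h1 : 1 ≤ log (n : ℝ) ^ θ := one_le_rpow hn hθ0.le
    rw [hl n, max_eq_right hn]
    exact ⟨hn, by exact_mod_cast Nat.le_floor (by exact_mod_cast h1), Nat.floor_le (by linarith)⟩
  have hpow : Tendsto (fun n : ℕ => log (n : ℝ) ^ (-(1 - θ))) atTop (nhds 0) :=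
    (tendsto_rpow_neg_atTop (by linarith)).comp hL
  have hlog : Tendsto (fun n : ℕ => log (log (n : ℝ)) / log (n : ℝ) ^ (1 - θ)) atTop (nhds 0) :=
    (isLittleO_log_rpow_atTop (by linarith : 0 < 1 - θ)).tendsto_div_nhds_zero.comp hL
  have hquot : ∀ᶠ n : ℕ in atTop, (l n : ℝ) / log n ≤ log (n : ℝ) ^ (-(1 - θ)) := by
    filter_upwards [hle] with n hn
    have hpos : 0 < log (n : ℝ) := by linarith [hn.1]
    rw [neg_sub, rpow_sub_one hpos.ne']
    exact div_le_div_of_nonneg_right hn.2.2 hpos.le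
  constructor
  · refine tendsto_of_tendsto_of_tendsto_of_le_of_le' tendsto_const_nhds hpow ?_ hquot
    filter_upwards [hle] with n hn
    exact div_nonneg (by linarith) (by linarith)
  · refine tendsto_of_tendsto_of_tendsto_of_le_of_le' tendsto_const_nhds
      (by simpa using hlog.const_mul θ) ?_ ?_
    · filter_upwards [hle] with n hn
      have := log_nonneg hn.2.1
      exact div_nonneg (mul_nonneg this (by linarith)) (by linarith)
    · filter_upwards [hle, hquot] with n hn hq
      have hpos : 0 < log (n : ℝ) := by linarith [hn.1]
      have h1 : log (l n) ≤ θ * log (log n) := by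
        rw [← log_rpow hpos]
        exact log_le_log (by linarith) hn.2.2
      have h2 : 0 ≤ θ * log (log (n : ℝ)) := mul_nonneg hθ0.le (log_nonneg hn.1)
      calc log (l n) * l n / log n = log (l n) * (l n / log n) := mul_div_assoc _ _ _
        _ ≤ θ * log (log n) * log (n : ℝ) ^ (-(1 - θ)) :=
          mul_le_mul h1 hq (div_nonneg (by linarith) hpos.le) h2
        _ = θ * (log (log n) / log (n : ℝ) ^ (1 - θ)) := by
          rw [rpow_neg hpos.le, div_eq_mul_inv, mul_assoc]

/-- With `k n = ⌊c * (2 log n / b) / l n⌋` blocks, the block inequality compares `c` with `1`. -/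
lemma VariesLikeLog.tendsto_blockIncrement_floor {a : ℕ → ℝ} {b : ℝ} (h : VariesLikeLog a b)
    (ha : Monotone a) (hb : 0 < b) {l : ℕ → ℕ} (hl : ∀ n, 1 ≤ l n)
    (hl1 : Tendsto (fun n : ℕ => (l n : ℝ) / log n) atTop (nhds 0))
    (hl2 : Tendsto (fun n : ℕ => log (l n) * l n / log n) atTop (nhds 0)) {c : ℝ} (hc : 0 < c) :
    Tendsto (fun n : ℕ => ⌊c * (2 * log n / b) / l n⌋₊) atTop atTop ∧
    Tendsto (fun n : ℕ => ((⌊c * (2 * log n / b) / l n⌋₊ * l n : ℕ) : ℝ) / (2 * log n / b))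
      atTop (nhds c) ∧
    Tendsto (fun n : ℕ => l n * blockIncrement a (l n) ⌊c * (2 * log n / b) / l n⌋₊ / (2 * log n))
      atTop (nhds c) := by
  have hL : Tendsto (fun n : ℕ => log n) atTop atTop :=
    tendsto_log_atTop.comp tendsto_natCast_atTop_atTop
  have hl0 : ∀ n, (0 : ℝ) < l n := fun n => by exact_mod_cast hl n
  have hLpos : ∀ᶠ n : ℕ in atTop, 0 < log (n : ℝ) := hL.eventually_gt_atTop 0
  have ht : Tendsto (fun n : ℕ => c * (2 * log n / b) / l n) atTop atTop := by
    have h1 : Tendsto (fun n : ℕ => (l n : ℝ) / log n) atTop (nhdsWithin 0 (Set.Ioi 0)) := by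
      refine tendsto_nhdsWithin_iff.mpr ⟨hl1, ?_⟩
      filter_upwards [hLpos] with n hn
      exact div_pos (hl0 n) hn
    refine (h1.inv_tendsto_nhdsGT_zero.const_mul_atTop (by positivity : 0 < c * 2 / b)).congr
      fun n => ?_
    simp only [Pi.inv_apply, inv_div]
    ring
  have hk : Tendsto (fun n : ℕ => ⌊c * (2 * log n / b) / l n⌋₊) atTop atTop :=
    tendsto_nat_floor_atTop.comp ht
  have hfloor : Tendsto (fun n : ℕ => (⌊c * (2 * log n / b) / l n⌋₊ : ℝ)
      / (c * (2 * log n / b) / l n)) atTop (nhds 1) := tendsto_nat_floor_div_atTop.comp ht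
  have hkl : Tendsto (fun n : ℕ => ((⌊c * (2 * log n / b) / l n⌋₊ * l n : ℕ) : ℝ)
      / (2 * log n / b)) atTop (nhds c) := by
    have h1 := hfloor.const_mul c
    rw [mul_one] at h1
    refine h1.congr' ?_
    filter_upwards [hLpos] with n hn
    have := hl0 n
    push_cast
    field_simp
  have hlogl : Tendsto (fun n : ℕ => log (l n) / (⌊c * (2 * log n / b) / l n⌋₊ : ℝ))
      atTop (nhds 0) := by
    have h1 := (hl2.const_mul (b / 2)).div hkl hc.ne'
    rw [mul_zero, zero_div] at h1
    refine h1.congr' ?_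
    filter_upwards [hLpos, hk.eventually_gt_atTop 0] with n hn hkn
    have := hl0 n
    have hkn' : (0 : ℝ) < ⌊c * (2 * log n / b) / l n⌋₊ := by exact_mod_cast hkn
    simp only [Pi.div_apply]
    push_cast
    generalize (⌊c * (2 * log n / b) / l n⌋₊ : ℝ) = q at *
    field_simp
  refine ⟨hk, hkl, ?_⟩
  have h1 := ((h.tendsto_blockIncrement_div ha hk hl hlogl).mul hkl).div_const b
  rw [mul_div_cancel_left₀ _ hb.ne'] at h1
  refine h1.congr' ?_
  filter_upwards [hLpos, hk.eventually_gt_atTop 0] with n hn hkn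
  have hkn' : (0 : ℝ) < ⌊c * (2 * log n / b) / l n⌋₊ := by exact_mod_cast hkn
  push_cast
  generalize blockIncrement a (l n) ⌊c * (2 * log n / b) / l n⌋₊ = G
  generalize (⌊c * (2 * log n / b) / l n⌋₊ : ℝ) = q at *
  field_simp

/-- Lemma 2: if the (0-based) nonincreasing positive eigenvalues satisfy `λ_j ∼ φ(j)` with `φ`
decreasing and regularly varying at infinity of index `-b < -1`, then with block length
`l_n = ⌊(max{1, log n})^θ⌋`, `θ ∈ (0,1)`, and number of blocks
`m(n,l) = max{k ≥ 1 : n^{1/k} λ_{(k-1)l}^{l/2} (∏_{j<k} λ_{jl})^{-l/(2k)} ≥ 1}`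
(here `λ_{jl}` is the leading eigenvalue of block `j`), one has
`m(n, l_n) · l_n ∼ 2 log n / b` as `n → ∞`. -/
theorem block_number_asymptotics
    (s b θ : ℝ) (hs : 0 ≤ s) (hb : 1 < b) (hθ0 : 0 < θ) (hθ1 : θ < 1)
    (φ : ℝ → ℝ)
    (hφpos : ∀ x, s < x → 0 < φ x)
    (hφdec : AntitoneOn φ (Set.Ioi s))
    (hφrv : ∀ c : ℝ, 0 < c →
      Tendsto (fun x : ℝ => φ (c * x) / φ x) atTop (nhds (c ^ (-b))))
    (lam : ℕ → ℝ) (hlampos : ∀ j, 0 < lam j) (hlamanti : Antitone lam)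
    (hlam : Tendsto (fun j : ℕ => lam j / φ j) atTop (nhds 1))
    (l m : ℕ → ℕ)
    (hl : ∀ n : ℕ, l n = ⌊(max 1 (Real.log n)) ^ θ⌋₊)
    (hm : ∀ n : ℕ, m n = sSup {k : ℕ | 1 ≤ k ∧
      1 ≤ (n : ℝ) ^ (1 / (k : ℝ)) * (lam ((k - 1) * l n)) ^ ((l n : ℝ) / 2)
            * (∏ j ∈ Finset.range k, lam (j * l n)) ^ (-(l n : ℝ) / (2 * k))}) :
    Tendsto (fun n : ℕ => ((m n * l n : ℕ) : ℝ) / (2 * Real.log n / b))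
      atTop (nhds 1) := by
  have hb0 : 0 < b := by linarith
  set a : ℕ → ℝ := fun j => -log (lam j)
  have hvar : VariesLikeLog a b := variesLikeLog_neg_log hφpos hφdec hφrv hlampos hlam
  have ha : Monotone a := fun i j hij => neg_le_neg (log_le_log (hlampos j) (hlamanti hij))
  have hl_one : ∀ n, 1 ≤ l n := fun n => by
    rw [hl n]
    exact Nat.le_floor (by exact_mod_cast one_le_rpow (le_max_left 1 (log (n : ℝ))) hθ0.le)
  obtain ⟨hl1, hl2⟩ := blockLength_asymptotics hθ0 hθ1 hl
  have hlim := fun {c : ℝ} (hc : 0 < c) =>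
    hvar.tendsto_blockIncrement_floor ha hb0 hl_one hl1 hl2 hc
  have hLpos : ∀ᶠ n : ℕ in atTop, 0 < log (n : ℝ) :=
    (tendsto_log_atTop.comp tendsto_natCast_atTop_atTop).eventually_gt_atTop 0
  have hset : ∀ n : ℕ, 1 ≤ n → m n = sSup {k : ℕ | 1 ≤ k ∧
      (l n : ℝ) * blockIncrement a (l n) k ≤ 2 * log n} := by
    intro n hn
    rw [hm n]
    congr 1
    ext k
    exact and_congr_right fun hk => one_le_block_iff hlampos hn hk
  have hupper : ∀ c : ℝ, 1 < c → ∀ᶠ n : ℕ in atTop, ⌊c * (2 * log n / b) / l n⌋₊ ∈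
      upperBounds {k : ℕ | 1 ≤ k ∧ (l n : ℝ) * blockIncrement a (l n) k ≤ 2 * log n} := by
    intro c hc
    filter_upwards [hLpos, (hlim (zero_lt_one.trans hc)).2.2.eventually (lt_mem_nhds hc)]
      with n hn h1 k hk
    rw [one_lt_div (by positivity)] at h1
    by_contra! hlt
    have h2 := mul_le_mul_of_nonneg_left (monotone_blockIncrement ha (l n) hlt.le)
      (Nat.cast_nonneg (α := ℝ) (l n))
    linarith [hk.2]
  have hmono : ∀ᶠ n : ℕ in atTop, ∀ p q : ℕ, p ≤ q →
      ((p * l n : ℕ) : ℝ) / (2 * log n / b) ≤ ((q * l n : ℕ) : ℝ) / (2 * log n / b) := by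
    filter_upwards [hLpos] with n hn p q hpq
    gcongr
  rw [tendsto_order]
  constructor
  · intro r hr
    obtain ⟨c, hrc, hc1⟩ := exists_between (max_lt hr zero_lt_one)
    obtain ⟨hrc, hc0⟩ := max_lt_iff.mp hrc
    obtain ⟨hk, hkl, hG⟩ := hlim hc0
    filter_upwards [hLpos, hmono, hupper 2 one_lt_two, hkl.eventually (lt_mem_nhds hrc),
      hG.eventually (gt_mem_nhds hc1), hk.eventually_ge_atTop 1, eventually_ge_atTop 1]
      with n hn h1 h2 h3 h4 h5 h6
    rw [div_lt_one (by positivity)] at h4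
    refine h3.trans_le (h1 _ _ ?_)
    rw [hset n h6]
    exact le_csSup ⟨_, h2⟩ ⟨h5, h4.le⟩
  · intro r hr
    obtain ⟨c, hc1, hcr⟩ := exists_between hr
    filter_upwards [hmono, hupper c hc1,
      (hlim (zero_lt_one.trans hc1)).2.1.eventually (gt_mem_nhds hcr), eventually_ge_atTop 1]
      with n h1 h2 h3 h4
    refine (h1 _ _ ?_).trans_lt h3
    rw [hset n h4]
    exact csSup_le' h2
end
end
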